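/- Let c = (c₁,…,cₙ) ∈ 𝒜⁺ and let 1 ≤ e₁ < e₂ ≤ n be ears of c. Then there exists ℓ with e₁ ≤ ℓ < e₂ such that: φ_j(e₁) < φ_j(e₂) for all j with e₁ ≤ j < ℓ; φ_j(e₁) > φ_j(e₂) for all j with ℓ < j ≤ e₂; and φ_ℓ(e₁) ≤ φ_ℓ(e₂). -/

import Mathlib

open Matrix Finset

/-- The matrix `η(a)` with rows `(a, -1)` and `(1, 0)`. -/
def etaM (a : ℤ) : Matrix (Fin 2) (Fin 2) ℤ := !![a, -1; 1, 0]

/-- The set `𝒜⁺` of η-sequences, as an inductive predicate on lists of integers. -/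
inductive IsEta : List ℤ → Prop
  | base : IsEta [0, 0]
  | rotate {c : List ℤ} : IsEta c → IsEta (c.rotate 1)
  | reverse {c : List ℤ} : IsEta c → IsEta c.reverse
  | expand {a b : ℤ} {t : List ℤ} : IsEta (a :: b :: t) → IsEta ((a + 1) :: 1 :: (b + 1) :: t)

/-- The `i`-th entry (1-indexed) of a sequence. -/
def entryOf (c : List ℤ) (i : ℕ) : ℤ := c.getD (i - 1) 0

/-- `φ_i(j)`: `0` if `i = j`; the (2,1)-entry of `η(c_i)⋯η(c_{j-1})` if `i < j`;
the (2,1)-entry of `η(c_j)⋯η(c_{i-1})` if `j < i`.  (Indices are 1-based.) -/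
def phi (c : List ℤ) (i j : ℕ) : ℤ :=
  if i = j then 0
  else if i < j then (((c.drop (i - 1)).take (j - i)).map etaM).prod 1 0
  else (((c.drop (j - 1)).take (i - j)).map etaM).prod 1 0

open Classical in
/-- `m_i`: the set of positions `j ∈ {1,…,n}` where `φ_i` attains its maximum. -/
noncomputable def mset (c : List ℤ) (i : ℕ) : Finset ℕ :=
  (Finset.Icc 1 c.length).filter (fun j => ∀ l ∈ Finset.Icc 1 c.length, phi c i l ≤ phi c i j)

/-- `i ⊕ k`: addition of 1-based indices, wrapping around modulo `n` (for `i + k ≤ 2n`). -/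
def addIdx (n i k : ℕ) : ℕ := if i + k ≤ n then i + k else i + k - n

/-- `c` is dense if for every `i ∈ {1,…,n}`, `|m_i| > 1` or `|m_{i+1}| > 1`
(indices taken cyclically). -/
def DenseSeq (c : List ℤ) : Prop :=
  ∀ i ∈ Finset.Icc 1 c.length,
    1 < (mset c i).card ∨ 1 < (mset c (addIdx c.length i 1)).card

/-- `c` is fan-shaped if a cyclic rotation of `c` equals `(n-2, 1, 2, …, 2, 1)`. -/
def IsFan (c : List ℤ) : Prop :=
  ∃ k, c.rotate k =
    ((c.length : ℤ) - 2) :: 1 :: (List.replicate (c.length - 3) (2 : ℤ) ++ [1])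

/-- The product `η(c₁)⋯η(cₙ)`. -/
abbrev etaProd (q : List ℤ) : Matrix (Fin 2) (Fin 2) ℤ := (q.map etaM).prod

lemma det_etaProd (q : List ℤ) : (etaProd q).det = 1 := by
  induction q with
  | nil => simp [etaProd]
  | cons a t ih =>
    simp only [etaProd, List.map_cons, List.prod_cons, det_mul] at ih ⊢
    rw [ih, etaM, det_fin_two_of]
    norm_num

lemma det_etaProd_entries (q : List ℤ) :
    etaProd q 0 0 * etaProd q 1 1 - etaProd q 0 1 * etaProd q 1 0 = 1 := by
  rw [← det_fin_two, det_etaProd]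

lemma etaProd_append (p q : List ℤ) : etaProd (p ++ q) = etaProd p * etaProd q := by
  simp [etaProd]

lemma etaProd_cons (a : ℤ) (q : List ℤ) : etaProd (a :: q) =
    !![a * etaProd q 0 0 - etaProd q 1 0, a * etaProd q 0 1 - etaProd q 1 1;
      etaProd q 0 0, etaProd q 0 1] := by
  simp only [etaProd, List.map_cons, List.prod_cons, etaM]
  ext i j
  fin_cases i <;> fin_cases j <;> simp [Matrix.mul_apply, Fin.sum_univ_two] <;> ring

lemma etaProd_expand (a b : ℤ) (t : List ℤ) :
    etaProd ((a + 1) :: 1 :: (b + 1) :: t) = etaProd (a :: b :: t) := by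
  simp only [etaProd_cons]
  ext i j
  fin_cases i <;> fin_cases j <;> simp <;> ring

lemma etaProd_reverse (q : List ℤ) : etaProd q.reverse =
    !![etaProd q 0 0, -etaProd q 1 0; -etaProd q 0 1, etaProd q 1 1] := by
  induction q with
  | nil => ext i j; fin_cases i <;> fin_cases j <;> simp [etaProd]
  | cons a t ih =>
    rw [List.reverse_cons, etaProd_append, ih, etaProd_cons]
    ext i j
    fin_cases i <;> fin_cases j <;>
      simp [etaProd, etaM, Matrix.mul_apply, Fin.sum_univ_two] <;> ring

/-- If `XY = -1` with `X` of determinant one, the off-diagonal entries of `X` and `Y` agree. -/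
lemma etaProd_offDiag_of_mul_eq_neg_one {p q : List ℤ} (h : etaProd p * etaProd q = -1) :
    etaProd q 1 0 = etaProd p 1 0 ∧ etaProd q 0 1 = etaProd p 0 1 := by
  have hd := det_etaProd_entries p
  have h00 := congrFun (congrFun h 0) 0
  have h01 := congrFun (congrFun h 0) 1
  have h10 := congrFun (congrFun h 1) 0
  have h11 := congrFun (congrFun h 1) 1
  simp only [Matrix.mul_apply, Fin.sum_univ_two, Matrix.neg_apply, one_fin_two, of_apply,
    cons_val', cons_val_zero, cons_val_one, cons_val_fin_one] at h00 h01 h10 h11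
  constructor
  · linear_combination -(etaProd q 1 0) * hd + etaProd p 0 0 * h10 - etaProd p 1 0 * h00
  · linear_combination -(etaProd q 0 1) * hd + etaProd p 1 1 * h01 - etaProd p 0 1 * h11

/-- The product over `c` is `-1`, and the off-diagonal entries of the product over every proper
nonempty infix have the signs of those of `η`. -/
def IsPositiveFrieze (c : List ℤ) : Prop :=
  etaProd c = -1 ∧ ∀ q, q <:+: c → q ≠ [] → q.length < c.length →
    0 < etaProd q 1 0 ∧ etaProd q 0 1 < 0

lemma IsPositiveFrieze.rotate {c : List ℤ} (h : IsPositiveFrieze c) :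
    IsPositiveFrieze (c.rotate 1) := by
  obtain _ | ⟨a, t⟩ := c
  · simpa using h
  obtain ⟨hp, hq⟩ := h
  rw [List.rotate_cons_succ, List.rotate_zero]
  have hcomm : etaProd t * etaProd [a] = -1 := by
    have h1 : etaProd [a] * etaProd t = -1 := by rw [← etaProd_append]; exact hp
    have h2 : (-etaProd [a]) * etaProd t = 1 := by rw [neg_mul, h1, neg_neg]
    have h3 := mul_eq_one_comm.mp h2
    rw [mul_neg] at h3
    rw [← neg_neg (etaProd t * etaProd [a]), h3]
  refine ⟨by rw [etaProd_append, hcomm], ?_⟩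
  intro q hqi hne hlen
  rcases List.infix_concat_iff.mp hqi with hs | hs
  · rcases List.suffix_concat_iff.mp hs with hnil | ⟨s, rfl, p, rfl⟩
    · exact absurd hnil hne
    · have hpne : p ≠ [] := by
        rintro rfl
        simp at hlen
      have key : etaProd p * etaProd (s ++ [a]) = -1 := by
        rw [← hcomm, etaProd_append, etaProd_append, mul_assoc]
      obtain ⟨e1, e2⟩ := etaProd_offDiag_of_mul_eq_neg_one key
      rw [e1, e2]
      refine hq p ⟨[a], s, by simp⟩ hpne ?_
      simp only [List.length_cons, List.length_append]
      omega
  · refine hq q (List.infix_cons hs) hne ?_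
    simpa using hlen

lemma IsPositiveFrieze.reverse {c : List ℤ} (h : IsPositiveFrieze c) :
    IsPositiveFrieze c.reverse := by
  obtain ⟨hp, hq⟩ := h
  constructor
  · rw [etaProd_reverse, hp]
    ext i j
    fin_cases i <;> fin_cases j <;> simp
  · intro q hqi hne hlen
    have := hq q.reverse (by simpa using List.reverse_infix.mpr hqi) (by simpa using hne)
      (by simpa using hlen)
    rw [etaProd_reverse] at this
    simp at this
    exact ⟨this.2, this.1⟩

lemma IsPositiveFrieze.expand {a b : ℤ} {t : List ℤ} (h : IsPositiveFrieze (a :: b :: t)) :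
    IsPositiveFrieze ((a + 1) :: 1 :: (b + 1) :: t) := by
  obtain ⟨hp, hq⟩ := h
  refine ⟨by rw [etaProd_expand, hp], ?_⟩
  have ha : 0 ≤ a := by
    obtain _ | ⟨d, t⟩ := t
    · have := congrFun (congrFun hp 0) 1
      simp [etaProd, etaM] at this
      exact this.ge
    · have := (hq [a, b] ⟨[], d :: t, by simp⟩ (by simp) (by simp)).2
      simp [etaProd, etaM] at this
      exact this.le
  have hnn : ∀ s, s <+: t → 0 ≤ etaProd (b :: s) 0 0 := by
    intro s hs
    by_cases hl : s = t
    · subst hl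
      have h0 := congrFun (congrFun hp 1) 0
      rw [etaProd_cons] at h0
      simp at h0
      exact h0.ge
    · have hlt : s.length < t.length :=
        lt_of_le_of_ne hs.length_le fun e => hl (hs.eq_of_length e)
      have := (hq (a :: b :: s) ((List.prefix_cons_inj a).mpr
        ((List.prefix_cons_inj b).mpr hs)).isInfix (by simp) (by simpa using hlt)).1
      rw [etaProd_cons] at this
      simp at this
      exact this.le
  have hb : ∀ s, s <+: t → 0 < etaProd (b :: s) 1 0 ∧ etaProd (b :: s) 0 1 < 0 := by
    intro s hs
    refine hq _ (List.infix_cons ((List.prefix_cons_inj b).mpr hs).isInfix) (by simp) ?_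
    have := hs.length_le
    simp only [List.length_cons]
    omega
  have hsub : ∀ s, s <:+: t → s ≠ [] → 0 < etaProd s 1 0 ∧ etaProd s 0 1 < 0 := by
    intro s hs hne
    refine hq s (List.infix_cons (List.infix_cons hs)) hne ?_
    have := hs.length_le
    simp only [List.length_cons]
    omega
  intro q hqi hne hlen
  rw [List.infix_cons_iff, List.infix_cons_iff, List.infix_cons_iff] at hqi
  rcases hqi with hpre | hpre | hpre | hinf
  · rcases List.prefix_cons_iff.mp hpre with rfl | ⟨q, rfl, hpre₁⟩
    · exact absurd rfl hne
    rcases List.prefix_cons_iff.mp hpre₁ with rfl | ⟨q, rfl, hpre₂⟩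
    · simp [etaProd, etaM]
    rcases List.prefix_cons_iff.mp hpre₂ with rfl | ⟨s, rfl, hs⟩
    · simp [etaProd, etaM]
      omega
    rw [etaProd_expand]
    exact hq _ ((List.prefix_cons_inj a).mpr ((List.prefix_cons_inj b).mpr hs)).isInfix
      (by simp) (by simpa using hlen)
  · rcases List.prefix_cons_iff.mp hpre with rfl | ⟨q, rfl, hpre₁⟩
    · exact absurd rfl hne
    rcases List.prefix_cons_iff.mp hpre₁ with rfl | ⟨s, rfl, hs⟩
    · simp [etaProd, etaM]
    have h0 := hnn s hs
    obtain ⟨h1, h2⟩ := hb s hs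
    simp only [etaProd_cons, of_apply, cons_val', cons_val_zero, cons_val_one,
      cons_val_fin_one] at h0 h1 h2 ⊢
    constructor <;> linarith
  · rcases List.prefix_cons_iff.mp hpre with rfl | ⟨s, rfl, hs⟩
    · exact absurd rfl hne
    obtain ⟨h1, h2⟩ := hb s hs
    have h3 : etaProd s 0 1 ≤ 0 := by
      by_cases hnil : s = []
      · subst hnil
        simp [etaProd]
      · exact (hsub s hs.isInfix hnil).2.le
    simp only [etaProd_cons, of_apply, cons_val', cons_val_zero, cons_val_one,
      cons_val_fin_one] at h1 h2 ⊢
    constructor <;> linarith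
  · exact hsub q hinf hne

lemma IsEta.isPositiveFrieze {c : List ℤ} (h : IsEta c) : IsPositiveFrieze c := by
  induction h with
  | base =>
    refine ⟨by ext i j; fin_cases i <;> fin_cases j <;> simp [etaProd, etaM], ?_⟩
    intro q hqi hne hlen
    have hq1 : q.length = 1 := by
      have := List.length_pos_iff.mpr hne
      simp at hlen
      omega
    obtain ⟨x, rfl⟩ := List.length_eq_one_iff.mp hq1
    simp [etaProd, etaM]
  | rotate _ ih => exact ih.rotate
  | reverse _ ih => exact ih.reverse
  | expand _ ih => exact ih.expand

lemma phi_self (c : List ℤ) (i : ℕ) : phi c i i = 0 := by simp [phi]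

lemma phi_comm (c : List ℤ) (i j : ℕ) : phi c i j = phi c j i := by
  unfold phi
  split_ifs <;> first | rfl | omega

lemma IsEta.phi_pos {c : List ℤ} (h : IsEta c) {i j : ℕ} (hi : 1 ≤ i) (hij : i < j)
    (hj : j ≤ c.length) : 0 < phi c i j := by
  rw [phi, if_neg hij.ne, if_pos hij]
  have hlen : ((c.drop (i - 1)).take (j - i)).length = j - i := by
    rw [List.length_take, List.length_drop]
    omega
  refine (h.isPositiveFrieze.2 _
    ((List.take_prefix _ _).isInfix.trans (List.drop_suffix _ _).isInfix) ?_ ?_).1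
  · rw [← List.length_pos_iff]
    omega
  · omega

/-- For `i ≤ j`, `φ_i(j)` is the determinant of the first columns of the two prefix products. -/
lemma phi_eq_det (c : List ℤ) {i j : ℕ} (hi : 1 ≤ i) (hij : i ≤ j) :
    phi c i j = etaProd (c.take (i - 1)) 0 0 * etaProd (c.take (j - 1)) 1 0 -
      etaProd (c.take (i - 1)) 1 0 * etaProd (c.take (j - 1)) 0 0 := by
  rcases hij.eq_or_lt with rfl | hlt
  · rw [phi_self]
    ring
  have htake : c.take (j - 1) = c.take (i - 1) ++ (c.drop (i - 1)).take (j - i) := by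
    rw [← List.take_add]
    congr 1
    omega
  rw [phi, if_neg hlt.ne, if_pos hlt, htake, etaProd_append]
  simp only [Matrix.mul_apply, Fin.sum_univ_two]
  linear_combination -(etaProd ((c.drop (i - 1)).take (j - i)) 1 0) *
    det_etaProd_entries (c.take (i - 1))

/-- The Ptolemy relation for `φ`. -/
lemma phi_ptolemy (c : List ℤ) {i j k l : ℕ} (hi : 1 ≤ i) (hij : i ≤ j) (hjk : j ≤ k)
    (hkl : k ≤ l) : phi c i k * phi c j l = phi c i j * phi c k l + phi c i l * phi c j k := by
  rw [phi_eq_det c hi (by omega : i ≤ k), phi_eq_det c (by omega) (by omega : j ≤ l),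
    phi_eq_det c hi hij, phi_eq_det c (by omega) hkl, phi_eq_det c hi (by omega : i ≤ l),
    phi_eq_det c (by omega) hjk]
  ring

theorem ears_crossing (c : List ℤ) (h : IsEta c) (e₁ e₂ : ℕ)
    (h1 : 1 ≤ e₁) (h12 : e₁ < e₂) (h2 : e₂ ≤ c.length)
    (he₁ : entryOf c e₁ = 1) (he₂ : entryOf c e₂ = 1) :
    ∃ l, e₁ ≤ l ∧ l < e₂ ∧
      (∀ j, e₁ ≤ j → j < l → phi c j e₁ < phi c j e₂) ∧
      (∀ j, l < j → j ≤ e₂ → phi c j e₁ > phi c j e₂) ∧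
      phi c l e₁ ≤ phi c l e₂ := by
  have h0 : 0 < phi c e₁ e₂ := h.phi_pos h1 h12 h2
  have hP : phi c e₁ e₁ ≤ phi c e₁ e₂ := by rw [phi_self]; exact h0.le
  let l := Nat.findGreatest (fun j => phi c j e₁ ≤ phi c j e₂) e₂
  have hle : e₁ ≤ l := Nat.le_findGreatest h12.le hP
  have hl : phi c l e₁ ≤ phi c l e₂ :=
    Nat.findGreatest_spec (P := fun j => phi c j e₁ ≤ phi c j e₂) h12.le hP
  have hlt : l < e₂ := by
    refine lt_of_le_of_ne (Nat.findGreatest_le _) fun e => ?_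
    rw [e, phi_self, phi_comm] at hl
    exact hl.not_gt h0
  refine ⟨l, hle, hlt, fun j hj hjl => ?_, fun j hlj hj => ?_, hl⟩
  · have hpos : 0 < phi c e₁ l := h.phi_pos h1 (by omega) (by omega)
    have hjl' : 0 < phi c j l := h.phi_pos (by omega) hjl (by omega)
    have hj0 : 0 ≤ phi c e₁ j := by
      rcases hj.eq_or_lt with rfl | hlt'
      · rw [phi_self]
      · exact (h.phi_pos h1 hlt' (by omega)).le
    have hpt := phi_ptolemy c h1 hj hjl.le hlt.le
    rw [phi_comm c l e₁] at hl
    rw [phi_comm c j e₁]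
    refine lt_of_mul_lt_mul_left ?_ hpos.le
    nlinarith [mul_le_mul_of_nonneg_left hl hj0, mul_pos h0 hjl']
  · exact not_le.mp (Nat.findGreatest_is_greatest hlj hj)
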